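/- There is an absolute constant c > 0 such that every nondeterministic circuit of size s and width w computing a Boolean function f : {0,1}^n → {0,1} can be converted to a deterministic circuit computing f of size at most 2^{c·(w + log₂ s)·log₂ s} and width at most w + c·log₂ s. -/

import Mathlib

/-!
Common definitions: Boolean circuits (with AND/OR/NOT gates of fan-in ≤ 2 and
dummy COPY gates used only for layering), nondeterministic circuits with guess
inputs, width via layerings, nondeterministic branching programs, and
U₂-circuits with their deterministic/nondeterministic circuit complexities.
-/

/-- A node of a circuit with `n` actual inputs and `m` guess inputs.
Gate nodes refer to their predecessors by (strictly smaller) indices. -/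
inductive CNode (n m : ℕ) : Type where
  | actual : Fin n → CNode n m
  | guess  : Fin m → CNode n m
  | const  : Bool → CNode n m
  | gand   : ℕ → ℕ → CNode n m
  | gor    : ℕ → ℕ → CNode n m
  | gnot   : ℕ → CNode n m
  | gcopy  : ℕ → CNode n m
deriving DecidableEq

namespace CNode

/-- The predecessor indices of a node. -/
def preds {n m : ℕ} : CNode n m → List ℕ
  | gand j k => [j, k]
  | gor j k  => [j, k]
  | gnot j   => [j]
  | gcopy j  => [j]
  | _        => []

/-- Real gates (AND, OR, NOT); these are the gates counted in the size.
COPY gates are dummy gates inserted only to make the circuit layered. -/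
def isGate {n m : ℕ} : CNode n m → Bool
  | gand _ _ => true
  | gor _ _  => true
  | gnot _   => true
  | _        => false

/-- Nodes occupying space in a layer (real gates and COPY gates);
these are counted in the width of a layer. -/
def isWide {n m : ℕ} : CNode n m → Bool
  | gand _ _ => true
  | gor _ _  => true
  | gnot _   => true
  | gcopy _  => true
  | _        => false

end CNode

/-- A (nondeterministic) Boolean circuit with `n` actual inputs and `m` guess
inputs: a DAG whose in-degree-0 nodes are labeled by actual inputs, guess
inputs or constants, whose gates are AND/OR/NOT gates (plus dummy COPY gates),
with a designated output node.  Each guess input labels at most one node. -/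
structure Circuit (n m : ℕ) : Type where
  N : ℕ
  node : Fin N → CNode n m
  output : Fin N
  wf : ∀ i : Fin N, ∀ j ∈ (node i).preds, j < (i : ℕ)
  guessOnce : ∀ g : Fin m,
    (Finset.univ.filter (fun i : Fin N => node i = CNode.guess g)).card ≤ 1

namespace Circuit

variable {n m : ℕ}

def nodeAt (c : Circuit n m) (i : ℕ) : CNode n m :=
  if h : i < c.N then c.node ⟨i, h⟩ else CNode.const false

/-- The Boolean value computed at node `i` on actual inputs `x` and
guess inputs `y`. -/
def evalAux (c : Circuit n m) (x : Fin n → Bool) (y : Fin m → Bool) : ℕ → Bool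
  | i =>
    match c.nodeAt i with
    | CNode.actual a => x a
    | CNode.guess g => y g
    | CNode.const b => b
    | CNode.gand j k =>
        (if _h : j < i then c.evalAux x y j else false) &&
        (if _h : k < i then c.evalAux x y k else false)
    | CNode.gor j k =>
        (if _h : j < i then c.evalAux x y j else false) ||
        (if _h : k < i then c.evalAux x y k else false)
    | CNode.gnot j => !(if _h : j < i then c.evalAux x y j else false)
    | CNode.gcopy j => (if _h : j < i then c.evalAux x y j else false)
termination_by i => i

/-- The output value of the circuit. -/
def eval (c : Circuit n m) (x : Fin n → Bool) (y : Fin m → Bool) : Bool :=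
  c.evalAux x y c.output

/-- A nondeterministic circuit computes `f` if for every actual input `x`,
`f x = 1` iff some assignment of the guess inputs makes the circuit output 1.
(For `m = 0` this is the usual notion for deterministic circuits.) -/
def Computes (c : Circuit n m) (f : (Fin n → Bool) → Bool) : Prop :=
  ∀ x : Fin n → Bool, f x = true ↔ ∃ y : Fin m → Bool, c.eval x y = true

/-- The size of a circuit: the number of (non-COPY) gates. -/
def size (c : Circuit n m) : ℕ :=
  (Finset.univ.filter (fun i : Fin c.N => (c.node i).isGate = true)).card

/-- `ℓ` is a layering of the circuit: every wire goes between adjacent layers. -/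
def IsLayering (c : Circuit n m) (ℓ : Fin c.N → ℕ) : Prop :=
  ∀ i : Fin c.N, ∀ j ∈ (c.node i).preds, ∀ hj : j < c.N, ℓ ⟨j, hj⟩ + 1 = ℓ i

/-- The circuit has width at most `w`: there is a layering in which every layer
contains at most `w` gates (real gates and COPY gates). -/
def HasWidth (c : Circuit n m) (w : ℕ) : Prop :=
  ∃ ℓ : Fin c.N → ℕ, c.IsLayering ℓ ∧
    ∀ t : ℕ,
      (Finset.univ.filter
        (fun i : Fin c.N => ℓ i = t ∧ (c.node i).isWide = true)).card ≤ w

/-- The circuit is read-`k`-times: every actual input labels at most `k` nodes. -/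
def ReadK (c : Circuit n m) (k : ℕ) : Prop :=
  ∀ a : Fin n,
    (Finset.univ.filter (fun i : Fin c.N => c.node i = CNode.actual a)).card ≤ k

/-- The maximal number of (non-COPY) gates on a path ending at node `i`. -/
def depthAux (c : Circuit n m) : ℕ → ℕ
  | i =>
    match c.nodeAt i with
    | CNode.actual _ => 0
    | CNode.guess _ => 0
    | CNode.const _ => 0
    | CNode.gand j k =>
        max (if _h : j < i then c.depthAux j else 0)
            (if _h : k < i then c.depthAux k else 0) + 1
    | CNode.gor j k =>
        max (if _h : j < i then c.depthAux j else 0)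
            (if _h : k < i then c.depthAux k else 0) + 1
    | CNode.gnot j => (if _h : j < i then c.depthAux j else 0) + 1
    | CNode.gcopy j => (if _h : j < i then c.depthAux j else 0)
termination_by i => i

/-- The depth of a circuit: the maximal number of gates on a directed path
from an input to the output. -/
def depth (c : Circuit n m) : ℕ := c.depthAux c.output

end Circuit

/-- A nondeterministic branching program on `n` Boolean variables: a DAG whose
inner nodes are labeled by variables with outgoing edges labeled 0 or 1 (edges
go to strictly larger indices), whose sinks are labeled 0 or 1, with a
designated start node. -/
structure NBP (n : ℕ) : Type where
  N : ℕ
  label : Fin N → Fin n ⊕ Bool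
  edges : Fin N → Bool → Finset (Fin N)
  start : Fin N
  wf : ∀ i : Fin N, ∀ b : Bool, ∀ j ∈ edges i b,
        (i : ℕ) < (j : ℕ) ∧ (label i).isLeft

namespace NBP

variable {n : ℕ}

/-- The size of a branching program: the number of its nodes. -/
def size (B : NBP n) : ℕ := B.N

/-- On input `x`, some path from node `i` consistent with `x` reaches a 1-sink. -/
def AccFrom (B : NBP n) (x : Fin n → Bool) : Fin B.N → Prop
  | i =>
    match B.label i with
    | Sum.inr b => b = true
    | Sum.inl v => ∃ j ∈ B.edges i (x v), ∃ _h : (i : ℕ) < (j : ℕ), B.AccFrom x j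
termination_by i => B.N - (i : ℕ)
decreasing_by
  have := j.isLt
  omega

/-- A nondeterministic branching program computes `f` if for every `x`,
`f x = 1` iff at least one path consistent with `x` leads to a 1-sink. -/
def Computes (B : NBP n) (f : (Fin n → Bool) → Bool) : Prop :=
  ∀ x : Fin n → Bool, f x = true ↔ B.AccFrom x B.start

/-- A (syntactic) path in the underlying graph of the branching program. -/
def IsPath (B : NBP n) : List (Fin B.N) → Prop
  | [] => True
  | [_] => True
  | i :: j :: p => (∃ b : Bool, j ∈ B.edges i b) ∧ B.IsPath (j :: p)

/-- The branching program is syntactic read-`k`-times: every variable appears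
at most `k` times on each path. -/
def SyntacticReadK (B : NBP n) (k : ℕ) : Prop :=
  ∀ p : List (Fin B.N), B.IsPath p → ∀ v : Fin n,
    (p.countP fun i => decide (B.label i = Sum.inl v)) ≤ k

end NBP

/-- A node of a `U₂`-circuit.  A gate `gate a b c j k` computes
`((vⱼ ⊕ a) ∧ (v_k ⊕ b)) ⊕ c` from the values `vⱼ, v_k` of its two
predecessors; these are exactly the Boolean functions in `U₂`
(all two-variable Boolean functions except XOR and its complement). -/
inductive U2Node (n m : ℕ) : Type where
  | actual : Fin n → U2Node n m
  | guess  : Fin m → U2Node n m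
  | const  : Bool → U2Node n m
  | gate   : Bool → Bool → Bool → ℕ → ℕ → U2Node n m
deriving DecidableEq

namespace U2Node

def isGate {n m : ℕ} : U2Node n m → Bool
  | gate _ _ _ _ _ => true
  | _ => false

end U2Node

/-- A (nondeterministic) `U₂`-circuit with `n` actual inputs and `m` guess
inputs: every gate has fan-in 2 and is labeled by a function in `U₂`. -/
structure U2Circuit (n m : ℕ) : Type where
  N : ℕ
  node : Fin N → U2Node n m
  output : Fin N
  wf : ∀ i : Fin N, ∀ a b c j k,
        node i = U2Node.gate a b c j k → j < (i : ℕ) ∧ k < (i : ℕ)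

namespace U2Circuit

variable {n m : ℕ}

def nodeAt (c : U2Circuit n m) (i : ℕ) : U2Node n m :=
  if h : i < c.N then c.node ⟨i, h⟩ else U2Node.const false

def evalAux (c : U2Circuit n m) (x : Fin n → Bool) (y : Fin m → Bool) : ℕ → Bool
  | i =>
    match c.nodeAt i with
    | U2Node.actual a => x a
    | U2Node.guess g => y g
    | U2Node.const b => b
    | U2Node.gate a b cc j k =>
        xor
          ((xor (if _h : j < i then c.evalAux x y j else false) a) &&
           (xor (if _h : k < i then c.evalAux x y k else false) b))
          cc
termination_by i => i

def eval (c : U2Circuit n m) (x : Fin n → Bool) (y : Fin m → Bool) : Bool :=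
  c.evalAux x y c.output

/-- A nondeterministic `U₂`-circuit computes `f` if for every actual input `x`,
`f x = 1` iff some assignment of the guess inputs makes the circuit output 1. -/
def Computes (c : U2Circuit n m) (f : (Fin n → Bool) → Bool) : Prop :=
  ∀ x : Fin n → Bool, f x = true ↔ ∃ y : Fin m → Bool, c.eval x y = true

/-- The size of a `U₂`-circuit: the number of its gates. -/
def size (c : U2Circuit n m) : ℕ :=
  (Finset.univ.filter (fun i : Fin c.N => (c.node i).isGate = true)).card

end U2Circuit

/-- `size^dc f`: the size of the smallest deterministic `U₂`-circuit
computing `f`. -/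
noncomputable def sizeDC {n : ℕ} (f : (Fin n → Bool) → Bool) : ℕ :=
  sInf {s : ℕ | ∃ c : U2Circuit n 0, c.Computes f ∧ c.size = s}

/-- `size^ndc f`: the size of the smallest nondeterministic `U₂`-circuit
computing `f`. -/
noncomputable def sizeNDC {n : ℕ} (f : (Fin n → Bool) → Bool) : ℕ :=
  sInf {s : ℕ | ∃ m : ℕ, ∃ c : U2Circuit n m, c.Computes f ∧ c.size = s}

/-- The parity function: `parityFun n x = 1` iff `Σ xᵢ ≡ 1 (mod 2)`. -/
def parityFun (n : ℕ) : (Fin n → Bool) → Bool :=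
  fun x => decide ((∑ i : Fin n, (x i).toNat) % 2 = 1)

theorem blockIdx_lt {m : ℕ} (i j : Fin m) : m * (i : ℕ) + (j : ℕ) < m * m := by
  have hi := i.isLt
  have hj := j.isLt
  nlinarith

/-- The disjunction of the parities of the `m` consecutive blocks of `m`
variables:
`⋁_{i=0}^{m-1} Parity_m (x_{m·i+1}, …, x_{m·i+m})` on `n = m²` variables. -/
def blockParityOr (m : ℕ) : (Fin (m * m) → Bool) → Bool :=
  fun x => decide (∃ i : Fin m,
    parityFun m (fun j => x ⟨m * (i : ℕ) + (j : ℕ), blockIdx_lt i j⟩) = true)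

namespace CNode

variable {n m : ℕ}

/-- The value of a node when its predecessors have the values given by `st`. -/
def eval (x : Fin n → Bool) (y : Fin m → Bool) (st : ℕ → Bool) : CNode n m → Bool
  | actual a => x a
  | guess g  => y g
  | const b  => b
  | gand j k => st j && st k
  | gor j k  => st j || st k
  | gnot j   => !st j
  | gcopy j  => st j

/-- Rename the predecessors of a node. -/
def rename (φ : ℕ → ℕ) : CNode n m → CNode n m
  | gand j k => gand (φ j) (φ k)
  | gor j k  => gor (φ j) (φ k)
  | gnot j   => gnot (φ j)
  | gcopy j  => gcopy (φ j)
  | u        => u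

theorem eval_congr {x : Fin n → Bool} {y : Fin m → Bool} {st st' : ℕ → Bool} {u : CNode n m}
    (h : ∀ j ∈ u.preds, st j = st' j) : u.eval x y st = u.eval x y st' := by
  cases u <;> simp_all [eval, preds]

theorem eval_rename (x : Fin n → Bool) (y : Fin m → Bool) (st : ℕ → Bool) (φ : ℕ → ℕ)
    (u : CNode n m) : (u.rename φ).eval x y st = u.eval x y (st ∘ φ) := by
  cases u <;> rfl

theorem preds_rename (φ : ℕ → ℕ) (u : CNode n m) : (u.rename φ).preds = u.preds.map φ := by
  cases u <;> rfl

theorem isWide_of_isGate {u : CNode n m} (h : u.isGate = true) : u.isWide = true := by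
  cases u <;> simp_all [isGate, isWide]

theorem length_preds_le_two (u : CNode n m) : u.preds.length ≤ 2 := by
  cases u <;> simp [preds]

end CNode

/-- A program for a register machine: each instruction writes the value of a node, whose
predecessors are registers, to a target register. -/
abbrev RegProgram (n : ℕ) : Type := List (ℕ × CNode n 0)

namespace RegProgram

variable {n : ℕ}

/-- The register contents after running a program. -/
def run (x : Fin n → Bool) (P : RegProgram n) (st : ℕ → Bool) : ℕ → Bool :=
  P.foldl (fun st p => Function.update st p.1 (p.2.eval x Fin.elim0 st)) st

theorem run_append (x : Fin n → Bool) (P Q : RegProgram n) (st : ℕ → Bool) :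
    run x (P ++ Q) st = run x Q (run x P st) := by
  simp [run]

theorem run_singleton (x : Fin n → Bool) (p : ℕ × CNode n 0) (st : ℕ → Bool) :
    run x [p] st = Function.update st p.1 (p.2.eval x Fin.elim0 st) := rfl

/-- The program uses only the registers below `K`. -/
def UsesBelow (P : RegProgram n) (K : ℕ) : Prop :=
  ∀ p ∈ P, p.1 < K ∧ ∀ j ∈ p.2.preds, j < K

/-- The instruction at position `t`. -/
def instr (P : RegProgram n) (t : ℕ) : ℕ × CNode n 0 := P.getD t (0, CNode.const false)

/-- The node of the unrolled program representing register `i % K` at time `i / K`. -/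
def unrollNode (P : RegProgram n) (K i : ℕ) : CNode n 0 :=
  if i / K = 0 then CNode.const false
  else if i % K = (instr P (i / K - 1)).1 then
    (instr P (i / K - 1)).2.rename fun j => (i / K - 1) * K + j
  else CNode.gcopy ((i / K - 1) * K + i % K)

theorem UsesBelow.instr {P : RegProgram n} {K : ℕ} (h : P.UsesBelow K) (t : ℕ) :
    ∀ j ∈ (P.instr t).2.preds, j < K := by
  intro j hj
  by_cases ht : t < P.length
  · rw [RegProgram.instr, List.getD_eq_getElem _ _ ht] at hj
    exact (h _ (List.getElem_mem ht)).2 j hj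
  · rw [RegProgram.instr, List.getD_eq_default _ _ (by omega)] at hj
    simp [CNode.preds] at hj

theorem exists_of_mem_preds_unrollNode {P : RegProgram n} {K i j : ℕ} (hK : 0 < K)
    (h : P.UsesBelow K) (hj : j ∈ (P.unrollNode K i).preds) :
    0 < i / K ∧ ∃ r < K, j = (i / K - 1) * K + r := by
  unfold unrollNode at hj
  split_ifs at hj with h₁ h₂
  · simp [CNode.preds] at hj
  · rw [CNode.preds_rename, List.mem_map] at hj
    obtain ⟨r, hr, rfl⟩ := hj
    exact ⟨Nat.pos_of_ne_zero h₁, r, h.instr _ r hr, rfl⟩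
  · simp only [CNode.preds, List.mem_singleton] at hj
    exact ⟨Nat.pos_of_ne_zero h₁, _, Nat.mod_lt _ hK, hj⟩

/-- The layered circuit whose layers are the register contents over time. -/
def toCircuit (P : RegProgram n) (K : ℕ) (hK : 0 < K) (h : P.UsesBelow K) : Circuit n 0 where
  N := (P.length + 1) * K
  node i := P.unrollNode K i
  output := ⟨P.length * K, Nat.mul_lt_mul_of_pos_right (Nat.lt_succ_self _) hK⟩
  wf := by
    intro i j hj
    obtain ⟨hi, r, hr, rfl⟩ := exists_of_mem_preds_unrollNode hK h hj
    have := Nat.div_add_mod (i : ℕ) K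
    obtain ⟨t, ht⟩ := Nat.exists_eq_add_of_lt hi
    rw [zero_add] at ht
    rw [ht] at this ⊢
    rw [Nat.add_sub_cancel]
    linarith [mul_comm K (t + 1), add_mul t 1 K, Nat.zero_le ((i : ℕ) % K)]
  guessOnce g := g.elim0

end RegProgram

namespace Circuit

variable {n m : ℕ}

theorem lt_of_mem_preds_nodeAt (C : Circuit n m) {i j : ℕ} (h : j ∈ (C.nodeAt i).preds) :
    j < i := by
  unfold nodeAt at h
  split_ifs at h with hi
  · exact C.wf ⟨i, hi⟩ j h
  · simp [CNode.preds] at h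

theorem evalAux_eq (C : Circuit n m) (x : Fin n → Bool) (y : Fin m → Bool) (i : ℕ) :
    C.evalAux x y i = (C.nodeAt i).eval x y (C.evalAux x y) := by
  have h : ∀ j ∈ (C.nodeAt i).preds, j < i := fun j hj => C.lt_of_mem_preds_nodeAt hj
  rw [evalAux]
  split <;> rename_i hi <;> rw [hi] at h ⊢ <;> simp_all [CNode.eval, CNode.preds]

end Circuit

namespace RegProgram

variable {n : ℕ} {P : RegProgram n} {K : ℕ} (hK : 0 < K) (h : P.UsesBelow K)

theorem evalAux_toCircuit (x : Fin n → Bool) (y : Fin 0 → Bool) {t r : ℕ} (ht : t ≤ P.length)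
    (hr : r < K) : (P.toCircuit K hK h).evalAux x y (t * K + r) =
      run x (P.take t) (fun _ => false) r := by
  have node_eq : ∀ {t r : ℕ}, t ≤ P.length → r < K →
      (P.toCircuit K hK h).nodeAt (t * K + r) = P.unrollNode K (t * K + r) := by
    intro t r ht hr
    have : t * K + r < (P.length + 1) * K := by nlinarith
    simp [Circuit.nodeAt, toCircuit, this]
  have hdiv : ∀ {t r : ℕ}, r < K → (t * K + r) / K = t := by
    intro t r hr
    rw [add_comm, Nat.add_mul_div_right _ _ hK, Nat.div_eq_of_lt hr, zero_add]
  have hmod : ∀ {t r : ℕ}, r < K → (t * K + r) % K = r := by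
    intro t r hr
    rw [add_comm, Nat.add_mul_mod_self_right, Nat.mod_eq_of_lt hr]
  obtain rfl : y = Fin.elim0 := funext fun i => i.elim0
  induction t generalizing r with
  | zero =>
    rw [Circuit.evalAux_eq, node_eq ht hr, unrollNode, if_pos (hdiv hr)]
    rfl
  | succ t ih =>
    have ih' : ∀ r < K, _ := fun r hr => ih (r := r) (by omega) hr
    have hlt : t < P.length := ht
    have htake : P.take (t + 1) = P.take t ++ [P.instr t] := by
      rw [List.take_add_one, List.getElem?_eq_getElem hlt, instr, List.getD_eq_getElem _ _ hlt]
      rfl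
    rw [Circuit.evalAux_eq, node_eq ht hr, unrollNode, hdiv hr, hmod hr, htake, run_append,
      run_singleton, if_neg (Nat.succ_ne_zero t), Nat.add_sub_cancel]
    split_ifs with hrt
    · rw [hrt, Function.update_self, CNode.eval_rename]
      exact CNode.eval_congr fun j hj => ih' j (h.instr t j hj)
    · rw [Function.update_of_ne hrt]
      exact ih' r hr

theorem size_toCircuit_le : (P.toCircuit K hK h).size ≤ P.length := by
  refine (Finset.card_le_card_of_injOn (t := (Finset.range P.length).image
    fun t => (t + 1) * K + (P.instr t).1) Fin.val ?_ Fin.val_injective.injOn).trans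
    (Finset.card_image_le.trans (Finset.card_range _).le)
  intro i hi
  have hi : (P.unrollNode K i).isGate = true := (Finset.mem_filter.1 hi).2
  have hlt : (i : ℕ) < (P.length + 1) * K := i.isLt
  have hdiv : (i : ℕ) / K < P.length + 1 := (Nat.div_lt_iff_lt_mul hK).2 hlt
  simp only [Finset.coe_image, Finset.coe_range, Set.mem_image, Set.mem_Iio]
  unfold unrollNode at hi
  split_ifs at hi with h₁ h₂
  · simp [CNode.isGate] at hi
  · have hpos := Nat.pos_of_ne_zero h₁
    refine ⟨(i : ℕ) / K - 1, (Nat.sub_lt hpos one_pos).trans_le (Nat.lt_succ_iff.1 hdiv), ?_⟩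
    rw [← h₂, Nat.sub_add_cancel (show 1 ≤ _ from hpos), mul_comm, Nat.div_add_mod]
  · simp [CNode.isGate] at hi

theorem hasWidth_toCircuit : (P.toCircuit K hK h).HasWidth K := by
  refine ⟨fun i => i / K, ?_, fun t => ?_⟩
  · intro i j hj hjN
    obtain ⟨hi, r, hr, rfl⟩ := exists_of_mem_preds_unrollNode hK h hj
    change (((i : ℕ) / K - 1) * K + r) / K + 1 = (i : ℕ) / K
    rw [add_comm, add_comm _ r, Nat.add_mul_div_right _ _ hK, Nat.div_eq_of_lt hr]
    omega
  · refine (Finset.card_le_card_of_injOn (t := (Finset.range K).image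
      fun r => t * K + r) Fin.val ?_ Fin.val_injective.injOn).trans
      (Finset.card_image_le.trans (Finset.card_range _).le)
    intro i hi
    have hi : (i : ℕ) / K = t := (by simpa using hi : _ ∧ _).1
    simp only [Finset.coe_image, Finset.coe_range, Set.mem_image, Set.mem_Iio]
    exact ⟨(i : ℕ) % K, Nat.mod_lt _ hK, by rw [← hi, mul_comm, Nat.div_add_mod]⟩

/-- The predicate `g` can be decided by programs of length at most `L` that use `k` consecutive
registers, leave the result in the first of them and do not touch the lower registers. -/
def Decides (k L : ℕ) (g : (Fin n → Bool) → Prop) : Prop :=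
  ∀ r, ∃ P : RegProgram n, P.length ≤ L ∧ P.UsesBelow (r + k) ∧
    ∀ x st, (run x P st r = true ↔ g x) ∧ ∀ r' < r, run x P st r' = st r'

namespace Decides

variable {k L k₁ L₁ k₂ L₂ : ℕ} {g g₁ g₂ : (Fin n → Bool) → Prop}

theorem mono (hg : Decides k₁ L₁ g) (hk : k₁ ≤ k₂) (hL : L₁ ≤ L₂) : Decides k₂ L₂ g := by
  intro r
  obtain ⟨P, hP, hu, hrun⟩ := hg r
  exact ⟨P, hP.trans hL, fun p hp => ⟨(hu p hp).1.trans_le (by omega),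
    fun j hj => ((hu p hp).2 j hj).trans_le (by omega)⟩, hrun⟩

theorem congr (hg : Decides k L g₁) (h : ∀ x, g₁ x ↔ g₂ x) : Decides k L g₂ := by
  obtain rfl : g₁ = g₂ := funext fun x => propext (h x)
  exact hg

theorem const (b : Bool) : Decides 1 1 fun _ : Fin n → Bool => b = true := by
  intro r
  refine ⟨[(r, .const b)], le_rfl, by simp [UsesBelow, CNode.preds], fun x st => ?_⟩
  simp only [run_singleton, Function.update_self, CNode.eval, true_and]
  exact fun r' hr' => Function.update_of_ne hr'.ne _ _

theorem actual (a : Fin n) : Decides 1 1 fun x : Fin n → Bool => x a = true := by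
  intro r
  refine ⟨[(r, .actual a)], le_rfl, by simp [UsesBelow, CNode.preds], fun x st => ?_⟩
  simp only [run_singleton, Function.update_self, CNode.eval, true_and]
  exact fun r' hr' => Function.update_of_ne hr'.ne _ _

theorem not (hg : Decides k L g) (hk : 0 < k) : Decides k (L + 1) fun x => ¬ g x := by
  intro r
  obtain ⟨P, hP, hu, hrun⟩ := hg r
  refine ⟨P ++ [(r, .gnot r)], by simpa using hP, ?_, fun x st => ⟨?_, fun r' hr' => ?_⟩⟩
  · intro p hp
    rcases List.mem_append.1 hp with hp | hp
    · exact hu p hp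
    · simp_all [CNode.preds]
  · rw [run_append, run_singleton, Function.update_self]
    simp [CNode.eval, ← (hrun x st).1]
  · rw [run_append, run_singleton, Function.update_of_ne hr'.ne, (hrun x st).2 r' hr']

theorem binary (hg₁ : Decides k₁ L₁ g₁) (hg₂ : Decides k₂ L₂ g₂) (hk : k₂ + 1 ≤ k₁)
    (hk₂ : 0 < k₂) (op : ℕ → ℕ → CNode n 0) (hop : ∀ i j, (op i j).preds = [i, j])
    (hop_eval : ∀ x st i j, (op i j).eval x Fin.elim0 st =
      (op 0 1).eval x Fin.elim0 fun a => if a = 0 then st i else st j)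
    (hg : ∀ x (b : ℕ → Bool), (b 0 = true ↔ g₁ x) → (b 1 = true ↔ g₂ x) →
      ((op 0 1).eval x Fin.elim0 b = true ↔ g x)) :
    Decides k₁ (L₁ + L₂ + 1) g := by
  intro r
  obtain ⟨P, hP, hu, hrun⟩ := hg₁ r
  obtain ⟨Q, hQ, hu', hrun'⟩ := hg₂ (r + 1)
  refine ⟨P ++ Q ++ [(r, op r (r + 1))], ?_, ?_, fun x st => ⟨?_, fun r' hr' => ?_⟩⟩
  · simp only [List.length_append, List.length_singleton]
    exact Nat.succ_le_succ (Nat.add_le_add hP hQ)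
  · intro p hp
    simp only [List.mem_append, List.mem_singleton] at hp
    rcases hp with (hp | hp) | rfl
    · exact hu p hp
    · exact ⟨(hu' p hp).1.trans_le (by omega), fun j hj => ((hu' p hp).2 j hj).trans_le (by omega)⟩
    · refine ⟨(by omega : r < r + k₁), fun j hj => ?_⟩
      simp only [hop, List.mem_cons, List.not_mem_nil, or_false] at hj
      omega
  · rw [run_append, run_append, run_singleton, Function.update_self]
    dsimp only
    rw [hop_eval]
    refine hg _ _ ?_ ?_
    · simp only [if_true]
      rw [(hrun' x _).2 r (by omega), (hrun x st).1]
    · simpa using (hrun' x _).1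
  · rw [run_append, run_append, run_singleton, Function.update_of_ne hr'.ne,
      (hrun' x _).2 r' (by omega), (hrun x st).2 r' hr']

theorem and (hg₁ : Decides k₁ L₁ g₁) (hg₂ : Decides k₂ L₂ g₂) (hk : k₂ + 1 ≤ k₁)
    (hk₂ : 0 < k₂) : Decides k₁ (L₁ + L₂ + 1) fun x => g₁ x ∧ g₂ x :=
  hg₁.binary hg₂ hk hk₂ .gand (fun _ _ => rfl) (by simp [CNode.eval])
    (by intro x b h₁ h₂; simp [CNode.eval, h₁, h₂])

theorem or (hg₁ : Decides k₁ L₁ g₁) (hg₂ : Decides k₂ L₂ g₂) (hk : k₂ + 1 ≤ k₁)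
    (hk₂ : 0 < k₂) : Decides k₁ (L₁ + L₂ + 1) fun x => g₁ x ∨ g₂ x :=
  hg₁.binary hg₂ hk hk₂ .gor (fun _ _ => rfl) (by simp [CNode.eval])
    (by intro x b h₁ h₂; simp [CNode.eval, h₁, h₂])

theorem exists_mem {ι : Type*} (S : Finset ι) {G : ι → (Fin n → Bool) → Prop}
    (hk : 0 < k) (hG : ∀ i ∈ S, Decides k L (G i)) :
    Decides (k + 1) (S.card * (L + 1) + 1) fun x => ∃ i ∈ S, G i x := by
  classical
  induction S using Finset.induction_on with
  | empty => exact ((const false).mono (by omega) (by simp)).congr (by simp)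
  | insert a S ha ih =>
    refine (((ih fun i hi => hG i (Finset.mem_insert_of_mem hi)).or
      (hG a (Finset.mem_insert_self a S)) le_rfl hk).mono le_rfl ?_).congr fun x => ?_
    · rw [Finset.card_insert_of_notMem ha]
      linarith
    · simp [or_comm]

theorem exists_circuit {f : (Fin n → Bool) → Bool} (hf : Decides k L fun x => f x = true)
    (hk : 0 < k) : ∃ D : Circuit n 0, D.Computes f ∧ D.size ≤ L ∧ D.HasWidth k := by
  obtain ⟨P, hP, hu, hrun⟩ := hf 0
  rw [zero_add] at hu
  refine ⟨P.toCircuit k hk hu, fun x => ?_, (size_toCircuit_le hk hu).trans hP,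
    hasWidth_toCircuit hk hu⟩
  have heval : ∀ y, (P.toCircuit k hk hu).eval x y = run x P (fun _ => false) 0 := by
    intro y
    have := evalAux_toCircuit hk hu x y le_rfl hk
    rwa [List.take_length] at this
  simp [heval, (hrun x _).1]

end Decides

end RegProgram

namespace Circuit

variable {n m : ℕ} (C : Circuit n m)

/-- The node from which `i` is obtained by a chain of COPY gates. -/
def root : ℕ → ℕ
  | i =>
    match C.nodeAt i with
    | CNode.gcopy j => if _h : j < i then root j else i
    | _ => i
termination_by i => i

theorem root_of_copy {i j : ℕ} (h : C.nodeAt i = .gcopy j) : C.root i = C.root j := by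
  have hj : j < i := C.lt_of_mem_preds_nodeAt (by simp [h, CNode.preds])
  rw [root, h]
  simp [hj]

theorem root_of_not_copy {i : ℕ} (h : ∀ j, C.nodeAt i ≠ .gcopy j) : C.root i = i := by
  rw [root]
  split
  · exact absurd ‹_› (h _)
  · rfl

/-- Induction along chains of COPY gates. -/
theorem copy_induction {motive : ℕ → Prop}
    (copy : ∀ i j, C.nodeAt i = .gcopy j → j < i → motive j → motive i)
    (base : ∀ i, (∀ j, C.nodeAt i ≠ .gcopy j) → motive i) (i : ℕ) : motive i := by
  induction i using Nat.strong_induction_on with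
  | _ i ih =>
    by_cases h : ∃ j, C.nodeAt i = .gcopy j
    · obtain ⟨j, h⟩ := h
      have hj : j < i := C.lt_of_mem_preds_nodeAt (by simp [h, CNode.preds])
      exact copy i j h hj (ih j hj)
    · exact base i (by simpa using h)

theorem root_le (i : ℕ) : C.root i ≤ i := by
  induction i using C.copy_induction with
  | copy i j h hj ih => rw [C.root_of_copy h]; omega
  | base i h => rw [C.root_of_not_copy h]

theorem nodeAt_root_ne_copy (i j : ℕ) : C.nodeAt (C.root i) ≠ .gcopy j := by
  induction i using C.copy_induction with
  | copy i k h hk ih => rwa [C.root_of_copy h]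
  | base i h => rw [C.root_of_not_copy h]; exact h j

theorem evalAux_root (x : Fin n → Bool) (y : Fin m → Bool) (i : ℕ) :
    C.evalAux x y (C.root i) = C.evalAux x y i := by
  induction i using C.copy_induction with
  | copy i j h hj ih => rw [C.root_of_copy h, ih, C.evalAux_eq x y i, h]; rfl
  | base i h => rw [C.root_of_not_copy h]

/-- The value read from node `i` when the guess inputs and gates have the values `v`. -/
def readVal (x : Fin n → Bool) (v : ℕ → Bool) (i : ℕ) : Bool :=
  match C.nodeAt (C.root i) with
  | .actual a => x a
  | .const b => b
  | _ => v (C.root i)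

/-- The value `v i` is the one computed by the gate `i`. -/
def Consistent (x : Fin n → Bool) (v : ℕ → Bool) (i : ℕ) : Prop :=
  v i = (C.nodeAt i).eval x (fun _ => false) (C.readVal x v)

theorem eval_eq_of_isGate {u : CNode n m} (hu : u.isGate = true) (x : Fin n → Bool)
    (y y' : Fin m → Bool) (st : ℕ → Bool) : u.eval x y st = u.eval x y' st := by
  cases u <;> simp_all [CNode.eval, CNode.isGate]

theorem readVal_evalAux (x : Fin n → Bool) (y : Fin m → Bool) (i : ℕ) :
    C.readVal x (C.evalAux x y) i = C.evalAux x y i := by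
  rw [← C.evalAux_root x y i, readVal]
  split <;> first | rfl | (rename_i h; rw [C.evalAux_eq, h]; rfl)

theorem guess_injective {i j : ℕ} {g : Fin m} (hi : C.nodeAt i = .guess g)
    (hj : C.nodeAt j = .guess g) : i = j := by
  unfold nodeAt at hi hj
  split_ifs at hi hj with hi' hj'
  simpa using Finset.card_le_one.1 (C.guessOnce g) ⟨i, hi'⟩ (by simpa using hi) ⟨j, hj'⟩
    (by simpa using hj)

theorem exists_evalAux_eq_readVal (x : Fin n → Bool) (v : ℕ → Bool)
    (hv : ∀ i, (C.nodeAt i).isGate = true → C.Consistent x v i) :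
    ∃ y, ∀ i, C.evalAux x y i = C.readVal x v i := by
  classical
  refine ⟨fun g => if h : ∃ i, C.nodeAt i = .guess g then v h.choose else false, fun i => ?_⟩
  induction i using Nat.strong_induction_on with
  | _ i ih =>
    have hpred := fun j (hj : j ∈ (C.nodeAt i).preds) => ih j (C.lt_of_mem_preds_nodeAt hj)
    rw [C.evalAux_eq]
    by_cases hgate : (C.nodeAt i).isGate = true
    · have hroot : C.root i = i := C.root_of_not_copy fun j hj => by
        simp [hj, CNode.isGate] at hgate
      have hread : C.readVal x v i = v i := by
        rw [readVal, hroot]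
        split <;> simp_all [CNode.isGate]
      rw [hread, hv i hgate, CNode.eval_congr hpred, eval_eq_of_isGate hgate]
    · rcases hi : C.nodeAt i with a | g | b | _ | _ | _ | j
      case gcopy =>
        rw [hi] at hpred
        simp only [CNode.preds, List.mem_singleton, forall_eq] at hpred
        rw [readVal, C.root_of_copy hi]
        exact hpred
      case guess =>
        have hroot : C.root i = i := C.root_of_not_copy (by simp [hi])
        have hex : ∃ i, C.nodeAt i = .guess g := ⟨i, hi⟩
        simp only [readVal, hroot, hi, CNode.eval, dif_pos hex]
        rw [C.guess_injective hex.choose_spec hi]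
      case actual => simp [readVal, C.root_of_not_copy (i := i) (by simp [hi]), hi, CNode.eval]
      case const => simp [readVal, C.root_of_not_copy (i := i) (by simp [hi]), hi, CNode.eval]
      all_goals simp [hi, CNode.isGate] at hgate

theorem exists_eval_iff (x : Fin n → Bool) : (∃ y, C.eval x y = true) ↔
    ∃ v, (∀ i, (C.nodeAt i).isGate = true → C.Consistent x v i) ∧
      C.readVal x v C.output = true := by
  constructor
  · rintro ⟨y, hy⟩
    refine ⟨C.evalAux x y, fun i hi => ?_, by rwa [readVal_evalAux]⟩
    rw [Consistent, C.evalAux_eq, eval_eq_of_isGate hi]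
    exact CNode.eval_congr fun j _ => (C.readVal_evalAux x y j).symm
  · rintro ⟨v, hv, hout⟩
    obtain ⟨y, hy⟩ := C.exists_evalAux_eq_readVal x v hv
    exact ⟨y, by rwa [eval, hy]⟩

/-- The nodes whose values occur in the consistency condition of gate `i`. -/
def scope (i : ℕ) : Finset ℕ := insert i ((C.nodeAt i).preds.map C.root).toFinset

theorem card_scope_le (i : ℕ) : (C.scope i).card ≤ 3 := by
  refine (Finset.card_insert_le _ _).trans (Nat.succ_le_succ ?_)
  refine (List.toFinset_card_le _).trans ?_
  rw [List.length_map]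
  exact CNode.length_preds_le_two _

theorem consistent_congr {x : Fin n → Bool} {v v' : ℕ → Bool} {i : ℕ}
    (h : ∀ u ∈ C.scope i, v u = v' u) : C.Consistent x v i ↔ C.Consistent x v' i := by
  have hread : ∀ j ∈ (C.nodeAt i).preds, C.readVal x v j = C.readVal x v' j := by
    intro j hj
    have hj' := h (C.root j) (Finset.mem_insert_of_mem (by simpa using ⟨j, hj, rfl⟩))
    unfold readVal
    split <;> first | rfl | exact hj'
  rw [Consistent, Consistent, h i (Finset.mem_insert_self _ _), CNode.eval_congr hread]

/-- The nodes whose values occur in the consistency conditions of the gates in `L`. -/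
def scopes (L : List ℕ) : Finset ℕ := L.toFinset.biUnion C.scope

theorem lt_of_isWide {i : ℕ} (h : (C.nodeAt i).isWide = true) : i < C.N := by
  by_contra hi
  simp [nodeAt, hi, CNode.isWide] at h

section Layering

variable {C} {ℓ : ℕ → ℕ}

theorem layer_root_le (hℓ : ∀ i, ∀ j ∈ (C.nodeAt i).preds, ℓ j + 1 = ℓ i) (i : ℕ) :
    ℓ (C.root i) ≤ ℓ i := by
  induction i using C.copy_induction with
  | copy i j h hj ih =>
    have := hℓ i j (by simp [h, CNode.preds])
    rw [C.root_of_copy h]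
    omega
  | base i h => rw [C.root_of_not_copy h]

theorem exists_isWide_root_eq (hℓ : ∀ i, ∀ j ∈ (C.nodeAt i).preds, ℓ j + 1 = ℓ i)
    {t : ℕ} (j : ℕ) (h₁ : ℓ (C.root j) ≤ t) (h₂ : t ≤ ℓ j)
    (h₃ : ℓ (C.root j) = t → (C.nodeAt (C.root j)).isWide = true) :
    ∃ i, ℓ i = t ∧ (C.nodeAt i).isWide = true ∧ C.root i = C.root j := by
  induction j using C.copy_induction with
  | copy i j h hj ih =>
    have hij := hℓ i j (by simp [h, CNode.preds])
    rcases h₂.eq_or_lt with h₂ | h₂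
    · exact ⟨i, h₂.symm, by simp [h, CNode.isWide], rfl⟩
    · rw [C.root_of_copy h] at h₁ h₃ ⊢
      exact ih h₁ (by omega) h₃
  | base i h =>
    rw [C.root_of_not_copy h] at h₁ h₃ ⊢
    exact ⟨i, by omega, h₃ (by omega), C.root_of_not_copy h⟩

theorem card_scopes_inter_le {w : ℕ} (hℓ : ∀ i, ∀ j ∈ (C.nodeAt i).preds, ℓ j + 1 = ℓ i)
    (hw : ∀ t, ((Finset.range C.N).filter
      fun i => ℓ i = t ∧ (C.nodeAt i).isWide = true).card ≤ w) {L₁ L₂ : List ℕ} {t : ℕ}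
    (hL₁ : ∀ i ∈ L₁, (C.nodeAt i).isGate = true ∧ ℓ i ≤ t)
    (hL₂ : ∀ i ∈ L₂, (C.nodeAt i).isGate = true ∧ t ≤ ℓ i) :
    (C.scopes L₁ ∩ C.scopes L₂).card ≤ 4 * w := by
  set S := (Finset.range C.N).filter fun i => ℓ i = t ∧ (C.nodeAt i).isWide = true with hS
  have hSw : S.card ≤ w := hw t
  have hsub : C.scopes L₁ ∩ C.scopes L₂ ⊆ S.image C.root ∪ S.biUnion C.scope := by
    intro u hu
    simp only [scopes, Finset.mem_inter, Finset.mem_biUnion, List.mem_toFinset] at hu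
    obtain ⟨⟨i₁, hi₁, hu₁⟩, i₂, hi₂, hu₂⟩ := hu
    have mem_S : ∀ i, ℓ i = t → (C.nodeAt i).isWide = true → i ∈ S := fun i h h' =>
      Finset.mem_filter.2 ⟨Finset.mem_range.2 (C.lt_of_isWide h'), h, h'⟩
    obtain ⟨hg₁, ht₁⟩ := hL₁ i₁ hi₁
    obtain ⟨hg₂, ht₂⟩ := hL₂ i₂ hi₂
    rcases ht₂.eq_or_lt with ht₂ | ht₂
    · exact Finset.mem_union_right _ (Finset.mem_biUnion.2
        ⟨i₂, mem_S i₂ ht₂.symm (CNode.isWide_of_isGate hg₂), hu₂⟩)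
    have hu₁' : ℓ u ≤ t ∧ (ℓ u = t → (C.nodeAt u).isWide = true) := by
      rcases Finset.mem_insert.1 hu₁ with rfl | hu₁
      · exact ⟨ht₁, fun _ => CNode.isWide_of_isGate hg₁⟩
      · obtain ⟨j, hj, rfl⟩ := by simpa using hu₁
        have := hℓ i₁ j hj
        have := layer_root_le hℓ j
        exact ⟨by omega, by omega⟩
    rcases Finset.mem_insert.1 hu₂ with rfl | hu₂
    · omega
    · obtain ⟨j, hj, rfl⟩ := by simpa using hu₂
      have := hℓ i₂ j hj
      obtain ⟨i, hi, hwide, hroot⟩ := exists_isWide_root_eq hℓ j hu₁'.1 (by omega) hu₁'.2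
      exact Finset.mem_union_left _ (Finset.mem_image.2 ⟨i, mem_S i hi hwide, hroot⟩)
  have h₁ : (S.image C.root).card ≤ w := Finset.card_image_le.trans hSw
  have h₂ : (S.biUnion C.scope).card ≤ S.card * 3 :=
    Finset.card_biUnion_le_card_mul _ _ _ fun i _ => C.card_scope_le i
  have := (Finset.card_le_card hsub).trans (Finset.card_union_le _ _)
  omega

end Layering

/-- Extensions of a partial assignment can be found by first extending it to `B`. -/
theorem exists_extension_iff (A B : Finset ℕ) (σ : ℕ → Bool) (Q : (ℕ → Bool) → Prop) :
    (∃ v, (∀ u ∈ A, v u = σ u) ∧ Q v) ↔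
      ∃ τ ∈ B.powerset, ∃ v : ℕ → Bool,
        (∀ u ∈ A ∪ B, v u = if u ∈ A then σ u else decide (u ∈ τ)) ∧ Q v := by
  constructor
  · rintro ⟨v, hv, hQ⟩
    refine ⟨B.filter fun u => v u = true, by simp, v, fun u hu => ?_, hQ⟩
    split_ifs with hA
    · exact hv u hA
    · have hB : u ∈ B := (Finset.mem_union.1 hu).resolve_left hA
      simp [hB]
  · rintro ⟨τ, -, v, hv, hQ⟩
    exact ⟨v, fun u hu => by simpa [hu] using hv u (Finset.mem_union_left _ hu), hQ⟩

open RegProgram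

theorem decides_readVal (v : ℕ → Bool) (j : ℕ) :
    Decides 1 1 fun x : Fin n → Bool => C.readVal x v j = true := by
  unfold readVal
  split <;> first | exact .actual _ | exact .const _

theorem decides_consistent (v : ℕ → Bool) {i : ℕ} (hi : (C.nodeAt i).isGate = true) :
    Decides 2 4 fun x : Fin n → Bool => C.Consistent x v i := by
  have hval : Decides 2 3 fun x : Fin n → Bool =>
      (C.nodeAt i).eval x (fun _ => false) (C.readVal x v) = true := by
    rcases h : C.nodeAt i with _ | _ | _ | ⟨j, k⟩ | ⟨j, k⟩ | j | _
    case gand =>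
      exact (((C.decides_readVal v j).mono one_le_two le_rfl).and (C.decides_readVal v k)
        le_rfl one_pos).congr (by simp [CNode.eval])
    case gor =>
      exact (((C.decides_readVal v j).mono one_le_two le_rfl).or (C.decides_readVal v k)
        le_rfl one_pos).congr (by simp [CNode.eval])
    case gnot =>
      exact (((C.decides_readVal v j).not one_pos).mono one_le_two (by omega)).congr
        (by simp [CNode.eval])
    all_goals simp [h, CNode.isGate] at hi
  cases hvi : v i
  · exact (hval.not two_pos).congr fun x => by
      rw [Consistent, hvi, Bool.not_eq_true, eq_comm]
  · exact (hval.mono le_rfl (by omega)).congr fun x => by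
      rw [Consistent, hvi, eq_comm]

theorem decides_exists_consistent {ℓ : ℕ → ℕ} {w : ℕ}
    (hℓ : ∀ i, ∀ j ∈ (C.nodeAt i).preds, ℓ j + 1 = ℓ i)
    (hw : ∀ t, ((Finset.range C.N).filter
      fun i => ℓ i = t ∧ (C.nodeAt i).isWide = true).card ≤ w) (h : ℕ) (L : List ℕ)
    (hL : L.length ≤ 2 ^ h) (hgate : ∀ i ∈ L, (C.nodeAt i).isGate = true)
    (hsort : L.Pairwise fun i j => ℓ i ≤ ℓ j) (A : Finset ℕ) (σ : ℕ → Bool) :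
    Decides (2 * h + 3) (2 ^ ((4 * w + 3) * h + 6)) fun x : Fin n → Bool =>
      ∃ v, (∀ u ∈ A, v u = σ u) ∧ ∀ i ∈ L, C.Consistent x v i := by
  induction h generalizing L A σ with
  | zero =>
    match L, hL with
    | [], _ =>
      exact ((Decides.const true).mono (by omega) Nat.one_le_two_pow).congr fun x => by
        simpa using ⟨σ, fun _ _ => rfl⟩
    | [i], _ =>
      refine ((Decides.exists_mem (C.scope i).powerset two_pos fun τ _ =>
        C.decides_consistent (fun u => if u ∈ A then σ u else decide (u ∈ τ))
          (hgate i (by simp))).mono (by omega) ?_).congr fun x => ?_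
      · have : 2 ^ (C.scope i).card ≤ 2 ^ 3 := Nat.pow_le_pow_right two_pos (C.card_scope_le i)
        rw [Finset.card_powerset]
        norm_num at this ⊢
        omega
      · rw [exists_extension_iff A (C.scope i)]
        refine exists_congr fun τ => and_congr_right fun _ => ?_
        simp only [List.mem_singleton, forall_eq]
        refine ⟨fun hc => ⟨_, fun _ _ => rfl, hc⟩, ?_⟩
        rintro ⟨v, hv, hc⟩
        exact (C.consistent_congr fun u hu => hv u (Finset.mem_union_right _ hu)).1 hc
  | succ h ih =>
    obtain ⟨L₁, L₂, rfl, hL₁, hL₂⟩ : ∃ L₁ L₂, L = L₁ ++ L₂ ∧ L₁.length ≤ 2 ^ h ∧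
        L₂.length ≤ 2 ^ h := by
      refine ⟨L.take (2 ^ h), L.drop (2 ^ h), (List.take_append_drop _ _).symm, ?_, ?_⟩
      · simp
      · rw [List.length_drop]
        rw [pow_succ] at hL
        omega
    obtain ⟨hsort₁, hsort₂, hcross⟩ := List.pairwise_append.1 hsort
    have hgate₁ : ∀ i ∈ L₁, (C.nodeAt i).isGate = true := fun i hi =>
      hgate i (List.mem_append_left _ hi)
    have hgate₂ : ∀ i ∈ L₂, (C.nodeAt i).isGate = true := fun i hi =>
      hgate i (List.mem_append_right _ hi)
    have hcard : (C.scopes L₁ ∩ C.scopes L₂).card ≤ 4 * w := by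
      rcases L₂ with _ | ⟨b, L₂⟩
      · simp [scopes]
      · refine card_scopes_inter_le hℓ hw (t := ℓ b)
          (fun i hi => ⟨hgate₁ i hi, hcross i hi b (by simp)⟩) fun i hi => ⟨hgate₂ i hi, ?_⟩
        rcases List.mem_cons.1 hi with rfl | hi
        · exact le_rfl
        · exact (List.pairwise_cons.1 hsort₂).1 i hi
    set B := C.scopes L₁ ∩ C.scopes L₂
    refine ((Decides.exists_mem B.powerset (by omega) fun τ _ =>
      ((ih L₁ hL₁ hgate₁ hsort₁ (A ∪ B) fun u => if u ∈ A then σ u else decide (u ∈ τ)).mono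
        (Nat.le_succ _) le_rfl).and
      (ih L₂ hL₂ hgate₂ hsort₂ (A ∪ B) fun u => if u ∈ A then σ u else decide (u ∈ τ))
        le_rfl (by omega)).mono (by omega) ?_).congr fun x => ?_
    · have hpow : 2 ^ B.card ≤ 2 ^ (4 * w) := Nat.pow_le_pow_right two_pos hcard
      have hpos : 1 ≤ 2 ^ (4 * w) := Nat.one_le_two_pow
      have hE : 2 ≤ 2 ^ ((4 * w + 3) * h + 6) :=
        (Nat.pow_le_pow_right two_pos (by omega : 1 ≤ (4 * w + 3) * h + 6))
      have hstep : 2 ^ ((4 * w + 3) * (h + 1) + 6) =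
          2 ^ (4 * w) * (8 * 2 ^ ((4 * w + 3) * h + 6)) := by
        rw [show (8 : ℕ) = 2 ^ 3 by norm_num, ← pow_add, ← pow_add]
        congr 1
        ring
      rw [Finset.card_powerset, hstep]
      generalize 2 ^ ((4 * w + 3) * h + 6) = E at *
      generalize 2 ^ B.card = b at *
      generalize 2 ^ (4 * w) = a at *
      calc b * (E + E + 1 + 1) + 1 ≤ a * (E + E + 1 + 1) + a := by gcongr
        _ = a * (E + E + 1 + 1 + 1) := by ring
        _ ≤ a * (8 * E) := by gcongr; omega
    · rw [exists_extension_iff A B]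
      refine exists_congr fun τ => and_congr_right fun _ => ?_
      constructor
      · rintro ⟨⟨v₁, hv₁, hc₁⟩, v₂, hv₂, hc₂⟩
        have hmem : ∀ {L : List ℕ} {i u : ℕ}, i ∈ L → u ∈ C.scope i → u ∈ C.scopes L :=
          fun hi hu => Finset.mem_biUnion.2 ⟨_, List.mem_toFinset.2 hi, hu⟩
        refine ⟨fun u => if u ∈ C.scopes L₁ then v₁ u else v₂ u, fun u hu => ?_, fun i hi => ?_⟩
        · dsimp only
          rw [hv₁ u hu, hv₂ u hu, ite_self]
        · rcases List.mem_append.1 hi with hi | hi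
          · exact (C.consistent_congr fun u hu => if_pos (hmem hi hu)).2 (hc₁ i hi)
          · refine (C.consistent_congr fun u hu => ?_).2 (hc₂ i hi)
            split_ifs with hu₁
            · have hu' : u ∈ A ∪ B :=
                Finset.mem_union_right _ (Finset.mem_inter.2 ⟨hu₁, hmem hi hu⟩)
              rw [hv₁ u hu', hv₂ u hu']
            · rfl
      · rintro ⟨v, hv, hc⟩
        exact ⟨⟨v, hv, fun i hi => hc i (List.mem_append_left _ hi)⟩,
          v, hv, fun i hi => hc i (List.mem_append_right _ hi)⟩

theorem exists_decides_circuit {ℓ : ℕ → ℕ} {w : ℕ}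
    (hℓ : ∀ i, ∀ j ∈ (C.nodeAt i).preds, ℓ j + 1 = ℓ i)
    (hw : ∀ t, ((Finset.range C.N).filter
      fun i => ℓ i = t ∧ (C.nodeAt i).isWide = true).card ≤ w)
    (hout : (C.nodeAt (C.root C.output)).isGate = true) {f : (Fin n → Bool) → Bool}
    (hf : C.Computes f) {h : ℕ} (hh : C.size ≤ 2 ^ h) :
    ∃ D : Circuit n 0, D.Computes f ∧ D.size ≤ 2 ^ ((4 * w + 3) * h + 6) ∧
      D.HasWidth (2 * h + 3) := by
  set gates := (Finset.range C.N).filter fun i => (C.nodeAt i).isGate = true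
  have mem_gates : ∀ i, i ∈ gates ↔ (C.nodeAt i).isGate = true := fun i => by
    simpa [gates] using fun h => C.lt_of_isWide (CNode.isWide_of_isGate h)
  have hcard : gates.card = C.size := by
    refine (Finset.card_bij (fun (i : Fin C.N) _ => (i : ℕ)) (fun i hi => ?_)
      (fun _ _ _ _ => Fin.ext) fun i hi => ?_).symm
    · simpa [mem_gates, nodeAt] using hi
    · have hlt := Finset.mem_range.1 (Finset.mem_filter.1 hi).1
      exact ⟨⟨i, hlt⟩, by simpa [mem_gates, nodeAt, hlt] using hi, rfl⟩
  set L := gates.toList.mergeSort fun i j => decide (ℓ i ≤ ℓ j)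
  have mem_L : ∀ i, i ∈ L ↔ (C.nodeAt i).isGate = true := by simp [L, mem_gates]
  have hL : L.length ≤ 2 ^ h := by simpa [L, hcard] using hh
  have hsort : L.Pairwise fun i j => ℓ i ≤ ℓ j := by
    simpa using List.pairwise_mergeSort (le := fun i j => decide (ℓ i ≤ ℓ j))
      (fun a b c => by simpa using le_trans) (fun a b => by simpa using le_total _ _) gates.toList
  refine Decides.exists_circuit ((C.decides_exists_consistent hℓ hw h L hL
    (fun i hi => (mem_L i).1 hi) hsort {C.root C.output} fun _ => true).congr fun x => ?_)
    (by omega)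
  have hread : ∀ v, C.readVal x v C.output = v (C.root C.output) := fun v => by
    unfold readVal
    split <;> simp_all [CNode.isGate]
  rw [hf x, C.exists_eval_iff]
  simp [mem_L, hread, and_comm]

/-- The circuit consisting of a single input node. -/
def ofInput (u : CNode n 0) (hu : u.preds = []) : Circuit n 0 where
  N := 1
  node _ := u
  output := 0
  wf := by simp [hu]
  guessOnce g := g.elim0

/-- The circuit consisting of a single gate and two input nodes. -/
def ofGate (a b g : CNode n 0) (ha : a.preds = []) (hb : b.preds = [])
    (hg : ∀ j ∈ g.preds, j < 2) : Circuit n 0 where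
  N := 3
  node := ![a, b, g]
  output := 2
  wf := by
    intro i
    fin_cases i
    · simp [ha]
    · simp [hb]
    · exact hg
  guessOnce g := g.elim0

theorem isWide_of_preds_eq_nil {u : CNode n m} (hu : u.preds = []) : u.isWide = false := by
  cases u <;> simp_all [CNode.preds, CNode.isWide]

theorem isGate_of_preds_eq_nil {u : CNode n m} (hu : u.preds = []) : u.isGate = false := by
  cases u <;> simp_all [CNode.preds, CNode.isGate]

theorem eval_ofInput (u : CNode n 0) (hu : u.preds = []) (x : Fin n → Bool) (y : Fin 0 → Bool)
    (st : ℕ → Bool) : (ofInput u hu).eval x y = u.eval x y st := by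
  rw [eval, evalAux_eq]
  exact CNode.eval_congr (by simp [ofInput, nodeAt, hu])

theorem size_ofInput (u : CNode n 0) (hu : u.preds = []) : (ofInput u hu).size = 0 :=
  Finset.card_eq_zero.2 (Finset.filter_eq_empty_iff.2 fun _ _ => by
    simp [ofInput, isGate_of_preds_eq_nil hu])

theorem hasWidth_ofInput (u : CNode n 0) (hu : u.preds = []) : (ofInput u hu).HasWidth 0 :=
  ⟨fun _ => 0, fun i => by simp [ofInput, hu],
    fun t => (Finset.card_eq_zero.2 (Finset.filter_eq_empty_iff.2 fun _ _ => by
      simp [ofInput, isWide_of_preds_eq_nil hu])).le⟩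

section ofGate

variable {a b g : CNode n 0} (ha : a.preds = []) (hb : b.preds = []) (hg : ∀ j ∈ g.preds, j < 2)

theorem eval_ofGate (x : Fin n → Bool) (y : Fin 0 → Bool) (st : ℕ → Bool) :
    (ofGate a b g ha hb hg).eval x y =
      g.eval x y fun i => if i = 0 then a.eval x y st else b.eval x y st := by
  have h₀ : (ofGate a b g ha hb hg).nodeAt 0 = a := rfl
  have h₁ : (ofGate a b g ha hb hg).nodeAt 1 = b := rfl
  have h₂ : (ofGate a b g ha hb hg).nodeAt 2 = g := rfl
  change (ofGate a b g ha hb hg).evalAux x y 2 = _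
  rw [evalAux_eq, h₂]
  refine CNode.eval_congr fun j hj => ?_
  have := hg j hj
  interval_cases j
  · rw [evalAux_eq, h₀]
    exact CNode.eval_congr (by simp [ha])
  · rw [evalAux_eq, h₁]
    exact CNode.eval_congr (by simp [hb])

theorem eq_two_of_isWide_ofGate (i : Fin 3)
    (hi : ((ofGate a b g ha hb hg).node i).isWide = true) : i = 2 := by
  fin_cases i
  · simp [ofGate, isWide_of_preds_eq_nil ha] at hi
  · simp [ofGate, isWide_of_preds_eq_nil hb] at hi
  · rfl

theorem size_ofGate_le : (ofGate a b g ha hb hg).size ≤ 1 := by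
  refine Finset.card_le_one.2 fun i hi j hj => ?_
  have h : ∀ i, _ → i = _ := eq_two_of_isWide_ofGate ha hb hg
  rw [h i (CNode.isWide_of_isGate (Finset.mem_filter.1 hi).2),
    h j (CNode.isWide_of_isGate (Finset.mem_filter.1 hj).2)]

theorem hasWidth_ofGate : (ofGate a b g ha hb hg).HasWidth 1 := by
  refine ⟨fun i => if (i : ℕ) = 2 then 1 else 0, ?_, fun t => ?_⟩
  · intro i j hj hjN
    change Fin 3 at i
    fin_cases i
    · simp [ofGate, ha] at hj
    · simp [ofGate, hb] at hj
    · have := hg j hj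
      interval_cases j <;> rfl
  · refine Finset.card_le_one.2 fun i hi j hj => ?_
    have h : ∀ i, _ → i = _ := eq_two_of_isWide_ofGate ha hb hg
    rw [h i (Finset.mem_filter.1 hi).2.2, h j (Finset.mem_filter.1 hj).2.2]

end ofGate

/-- A node obtained by copying an input is monotone in the guess inputs, and becomes an actual
input or a constant when these are fixed. -/
theorem exists_input {j : ℕ} (hj : (C.nodeAt (C.root j)).isGate = false) (c : Bool) :
    ∃ u : CNode n 0, u.preds = [] ∧ ∀ x st, u.eval x Fin.elim0 st = C.evalAux x (fun _ => c) j ∧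
      ∀ y, C.evalAux x y j = c → C.evalAux x (fun _ => c) j = c := by
  simp only [← C.evalAux_root _ _ j, C.evalAux_eq _ _ (C.root j)]
  have hne := C.nodeAt_root_ne_copy j
  generalize C.nodeAt (C.root j) = u at hj hne
  rcases u with a | g | b | _ | _ | _ | k
  case actual => exact ⟨.actual a, rfl, fun x st => ⟨rfl, fun y => id⟩⟩
  case guess => exact ⟨.const c, rfl, fun x st => ⟨rfl, fun y _ => rfl⟩⟩
  case const => exact ⟨.const b, rfl, fun x st => ⟨rfl, fun y => id⟩⟩
  case gcopy => exact absurd rfl (hne k)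
  all_goals simp [CNode.isGate] at hj

theorem exists_circuit_of_output_input {f : (Fin n → Bool) → Bool} (hf : C.Computes f)
    (hout : (C.nodeAt (C.root C.output)).isGate = false) :
    ∃ D : Circuit n 0, D.Computes f ∧ D.size = 0 ∧ D.HasWidth 0 := by
  obtain ⟨u, hu, huv⟩ := C.exists_input hout true
  refine ⟨ofInput u hu, fun x => ?_, size_ofInput u hu, hasWidth_ofInput u hu⟩
  have hD : ∀ y, (ofInput u hu).eval x y = C.eval x fun _ => true := fun y => by
    rw [eval_ofInput u hu x y fun _ => false, Subsingleton.elim y Fin.elim0, (huv x _).1, eval]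
  rw [hf x]
  simp only [hD, exists_const]
  exact ⟨fun ⟨y, hy⟩ => (huv x fun _ => false).2 y hy, fun h => ⟨_, h⟩⟩

theorem exists_circuit_of_size_le_one {f : (Fin n → Bool) → Bool} (hf : C.Computes f)
    (hout : (C.nodeAt (C.root C.output)).isGate = true) (hsize : C.size ≤ 1) :
    ∃ D : Circuit n 0, D.Computes f ∧ D.size ≤ 1 ∧ D.HasWidth 1 := by
  have hpred : ∀ j ∈ (C.nodeAt (C.root C.output)).preds,
      (C.nodeAt (C.root j)).isGate = false := by
    intro j hj
    by_contra hgate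
    rw [Bool.not_eq_false] at hgate
    have hlt := C.lt_of_mem_preds_nodeAt hj
    have hle := C.root_le j
    have h₁ := C.lt_of_isWide (CNode.isWide_of_isGate hout)
    have h₂ := C.lt_of_isWide (CNode.isWide_of_isGate hgate)
    have := Finset.card_le_one.1 hsize ⟨_, h₁⟩ (by simpa [nodeAt, h₁] using hout) ⟨_, h₂⟩
      (by simpa [nodeAt, h₂] using hgate)
    simp only [Fin.mk.injEq] at this
    omega
  have hfx : ∀ x, f x = true ↔ ∃ y, (C.nodeAt (C.root C.output)).eval x y (C.evalAux x y) = true :=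
    fun x => by simp only [hf x, ← C.evalAux_eq, C.evalAux_root, eval]
  have main : ∀ (a b g : CNode n 0) (ha : a.preds = []) (hb : b.preds = [])
      (hg : ∀ j ∈ g.preds, j < 2), (∀ x, f x = true ↔ (g.eval x Fin.elim0 fun i =>
        if i = 0 then a.eval x Fin.elim0 fun _ => false
        else b.eval x Fin.elim0 fun _ => false) = true) →
      ∃ D : Circuit n 0, D.Computes f ∧ D.size ≤ 1 ∧ D.HasWidth 1 := by
    intro a b g ha hb hg h
    refine ⟨ofGate a b g ha hb hg, fun x => ?_, size_ofGate_le ha hb hg, hasWidth_ofGate ha hb hg⟩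
    have hD : ∀ y, _ := fun y => eval_ofGate ha hb hg x y fun _ => false
    simp only [hD, h x]
    exact ⟨fun hx => ⟨_, hx⟩, fun ⟨y, hy⟩ => by rwa [Subsingleton.elim y Fin.elim0] at hy⟩
  rcases hnode : C.nodeAt (C.root C.output) with _ | _ | _ | ⟨j, k⟩ | ⟨j, k⟩ | j | _
  case gand =>
    obtain ⟨u, hu, huv⟩ := C.exists_input (hpred j (by simp [hnode, CNode.preds])) true
    obtain ⟨u', hu', huv'⟩ := C.exists_input (hpred k (by simp [hnode, CNode.preds])) true
    refine main u u' (.gand 0 1) hu hu' (by simp [CNode.preds]) fun x => ?_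
    rw [hfx, hnode]
    simp only [huv, huv']
    simp only [CNode.eval, if_true, one_ne_zero, if_false, Bool.and_eq_true]
    exact ⟨fun ⟨y, h₁, h₂⟩ => ⟨(huv x fun _ => false).2 y h₁, (huv' x fun _ => false).2 y h₂⟩,
      fun h => ⟨_, h⟩⟩
  case gor =>
    obtain ⟨u, hu, huv⟩ := C.exists_input (hpred j (by simp [hnode, CNode.preds])) true
    obtain ⟨u', hu', huv'⟩ := C.exists_input (hpred k (by simp [hnode, CNode.preds])) true
    refine main u u' (.gor 0 1) hu hu' (by simp [CNode.preds]) fun x => ?_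
    rw [hfx, hnode]
    simp only [huv, huv']
    simp only [CNode.eval, if_true, one_ne_zero, if_false, Bool.or_eq_true]
    exact ⟨fun ⟨y, h⟩ => h.imp ((huv x fun _ => false).2 y) ((huv' x fun _ => false).2 y),
      fun h => ⟨_, h⟩⟩
  case gnot =>
    obtain ⟨u, hu, huv⟩ := C.exists_input (hpred j (by simp [hnode, CNode.preds])) false
    refine main u u (.gnot 0) hu hu (by simp [CNode.preds]) fun x => ?_
    rw [hfx, hnode]
    simp only [huv]
    simp only [CNode.eval, if_true, Bool.not_eq_true']
    exact ⟨fun ⟨y, h⟩ => (huv x fun _ => false).2 y h, fun h => ⟨_, h⟩⟩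
  all_goals simp [hnode, CNode.isGate] at hout

/-- A layering can be extended to all natural numbers as node indices. -/
theorem HasWidth.exists_layering {w : ℕ} (h : C.HasWidth w) : ∃ ℓ : ℕ → ℕ,
    (∀ i, ∀ j ∈ (C.nodeAt i).preds, ℓ j + 1 = ℓ i) ∧
    ∀ t, ((Finset.range C.N).filter
      fun i => ℓ i = t ∧ (C.nodeAt i).isWide = true).card ≤ w := by
  obtain ⟨ℓ, hℓ, hw⟩ := h
  refine ⟨fun i => if hi : i < C.N then ℓ ⟨i, hi⟩ else 0, fun i j hj => ?_, fun t => ?_⟩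
  · have hji := C.lt_of_mem_preds_nodeAt hj
    by_cases hi : i < C.N
    · have hjN : j < C.N := hji.trans hi
      simp only [dif_pos hi, dif_pos hjN]
      exact hℓ ⟨i, hi⟩ j (by simpa [nodeAt, hi] using hj) hjN
    · simp [nodeAt, hi, CNode.preds] at hj
  · refine le_trans (Finset.card_le_card_of_surjOn Fin.val fun i hi => ?_) (hw t)
    obtain ⟨hi, hlay, hwide⟩ := by simpa using hi
    exact ⟨⟨i, hi⟩, by simpa [nodeAt, hi] using ⟨by simpa [hi] using hlay, by
      simpa [nodeAt, hi] using hwide⟩, rfl⟩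

end Circuit

/-- There is an absolute constant `c > 0` such that every
nondeterministic circuit of size `s` and width `w` computing a Boolean function
`f` can be converted to a deterministic circuit computing `f` of size at most
`2^(c·(w + log₂ s)·log₂ s)` and width at most `w + c·log₂ s`. -/
theorem ndc_to_dc_bounded_width :
    ∃ c : ℝ, 0 < c ∧
      ∀ (n m : ℕ) (C : Circuit n m) (f : (Fin n → Bool) → Bool) (w : ℕ),
        C.Computes f → C.HasWidth w →
        ∃ D : Circuit n 0, D.Computes f ∧
          (D.size : ℝ) ≤
            2 ^ (c * ((w : ℝ) + Real.logb 2 (C.size : ℝ)) * Real.logb 2 (C.size : ℝ)) ∧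
          ∃ w' : ℕ, D.HasWidth w' ∧ (w' : ℝ) ≤ (w : ℝ) + c * Real.logb 2 (C.size : ℝ) := by
  refine ⟨20, by norm_num, fun n m C f w hf hwidth => ?_⟩
  obtain ⟨ℓ, hℓ, hw⟩ := hwidth.exists_layering
  have hlog : 0 ≤ Real.logb 2 (C.size : ℝ) := by
    rcases Nat.eq_zero_or_pos C.size with h | h
    · simp [h]
    · exact Real.logb_nonneg one_lt_two (by exact_mod_cast h)
  have hsize : (1 : ℝ) ≤
      2 ^ (20 * ((w : ℝ) + Real.logb 2 (C.size : ℝ)) * Real.logb 2 (C.size : ℝ)) :=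
    Real.one_le_rpow one_le_two (by positivity)
  rcases hout : (C.nodeAt (C.root C.output)).isGate with _ | _
  · obtain ⟨D, hD, hDsize, hDw⟩ := C.exists_circuit_of_output_input hf hout
    refine ⟨D, hD, ?_, 0, hDw, ?_⟩
    · rw [hDsize, Nat.cast_zero]
      positivity
    · rw [Nat.cast_zero]
      positivity
  have hwide := CNode.isWide_of_isGate hout
  have hw_pos : 1 ≤ w := (Finset.card_pos.2 ⟨C.root C.output, Finset.mem_filter.2
    ⟨Finset.mem_range.2 (C.lt_of_isWide hwide), rfl, hwide⟩⟩).trans_le (hw _)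
  rcases le_or_gt C.size 1 with hs | hs
  · obtain ⟨D, hD, hDsize, hDw⟩ := C.exists_circuit_of_size_le_one hf hout hs
    refine ⟨D, hD, le_trans (by exact_mod_cast hDsize) hsize, 1, hDw, ?_⟩
    have : (1 : ℝ) ≤ w := by exact_mod_cast hw_pos
    push_cast
    linarith
  · obtain ⟨D, hD, hDsize, hDw⟩ := C.exists_decides_circuit hℓ hw hout hf
      (Nat.le_pow_clog one_lt_two C.size)
    set h := Nat.clog 2 C.size
    set s := Real.logb 2 (C.size : ℝ)
    have hs_pos : (0 : ℝ) < C.size := by positivity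
    have hs_one : 1 ≤ s := by
      rw [Real.le_logb_iff_rpow_le one_lt_two hs_pos, Real.rpow_one]
      exact_mod_cast hs
    have hhs : (h : ℝ) ≤ s + 1 := by
      have h_lt : 2 ^ (h - 1) < C.size := Nat.pow_pred_clog_lt_self one_lt_two hs
      have h_le : ((h - 1 : ℕ) : ℝ) ≤ s := by
        rw [Real.le_logb_iff_rpow_le one_lt_two hs_pos, Real.rpow_natCast]
        exact_mod_cast h_lt.le
      have : (h : ℝ) ≤ ((h - 1 : ℕ) : ℝ) + 1 := by
        exact_mod_cast Nat.le_add_of_sub_le (le_refl (h - 1))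
      linarith
    refine ⟨D, hD, ?_, 2 * h + 3, hDw, ?_⟩
    · refine le_trans (b := (2 : ℝ) ^ (((4 * w + 3) * h + 6 : ℕ) : ℝ)) ?_
        (Real.rpow_le_rpow_of_exponent_le one_le_two ?_)
      · rw [Real.rpow_natCast]
        exact_mod_cast hDsize
      · push_cast
        have hw_nonneg : (0 : ℝ) ≤ w := w.cast_nonneg
        have : (4 * w + 3) * (h : ℝ) ≤ (4 * w + 3) * (2 * s) :=
          mul_le_mul_of_nonneg_left (by linarith) (by linarith)
        nlinarith [mul_nonneg hw_nonneg hlog]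
    · push_cast
      linarith [(w.cast_nonneg : (0 : ℝ) ≤ w)]
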